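/- arXiv:1702.00875 — 2 statements merged into one kernel-verified Lean document; each statement's English description precedes it below -/
import Mathlib

section
/- Let d ≥ 1 and N ≥ 0 be integers and let f : ℝ^d → ℂ be a continuous function satisfying Fréchet's functional equation Δ_h^{N+1} f = 0 for all h ∈ ℝ^d, i.e. ∑_{j=0}^{N+1} binom(N+1,j) (−1)^{N+1−j} f(x + j·h) = 0 for all x, h ∈ ℝ^d, where j·h denotes the scalar multiple of h by the integer j. Then f is a polynomial function of total degree at most N. -/
/-- `f : ℝ^d → ℂ` is a polynomial function of total degree at most `N`. -/
def IsPolyFunOfDegLE {d : ℕ} (f : (Fin d → ℝ) → ℂ) (N : ℕ) : Prop :=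
  ∃ p : MvPolynomial (Fin d) ℂ, p.totalDegree ≤ N ∧
    ∀ x : Fin d → ℝ, f x = MvPolynomial.eval (fun j => (x j : ℂ)) p

open Polynomial in
/-- A sequence annihilated by the `(N + 1)`-st forward difference is a polynomial of degree at
most `N`. -/
theorem exists_polynomial_of_fwdDiff_iter_eq_zero {N : ℕ} {u : ℕ → ℂ}
    (hu : (fwdDiff 1)^[N + 1] u = 0) :
    ∃ Q : ℂ[X], Q.natDegree ≤ N ∧ ∀ n : ℕ, u n = Q.eval (n : ℂ) := by
  have hzero : ∀ k, N + 1 ≤ k → (fwdDiff 1)^[k] u = 0 := by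
    intro k hk
    induction k, hk using Nat.le_induction with
    | base => exact hu
    | succ k _ ih =>
      rw [Function.iterate_succ_apply', ih]
      ext
      simp [fwdDiff]
  refine ⟨∑ k ∈ Finset.range (N + 1),
    C ((fwdDiff 1)^[k] u 0 / (k.factorial : ℂ)) * descPochhammer ℂ k, ?_, fun n => ?_⟩
  · refine natDegree_sum_le_of_forall_le _ _ fun k hk => ?_
    refine (natDegree_C_mul_le _ _).trans ?_
    rw [descPochhammer_natDegree]
    exact Nat.lt_succ_iff.mp (Finset.mem_range.mp hk)
  · have key := shift_eq_sum_fwdDiff_iter (1 : ℕ) u n 0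
    simp only [smul_eq_mul, mul_one, zero_add] at key
    have hN : ∑ k ∈ Finset.range (N + 1), n.choose k • (fwdDiff 1)^[k] u 0
        = ∑ k ∈ Finset.range (n + N + 1), n.choose k • (fwdDiff 1)^[k] u 0 := by
      refine Finset.sum_subset (by intro; simp; omega) fun k _ hk => ?_
      rw [hzero k (by simpa using hk)]
      simp
    have hn : ∑ k ∈ Finset.range (n + 1), n.choose k • (fwdDiff 1)^[k] u 0
        = ∑ k ∈ Finset.range (n + N + 1), n.choose k • (fwdDiff 1)^[k] u 0 := by
      refine Finset.sum_subset (by intro; simp; omega) fun k _ hk => ?_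
      rw [Nat.choose_eq_zero_of_lt (by simpa using hk), zero_smul]
    rw [key, hn, ← hN, eval_finsetSum]
    refine Finset.sum_congr rfl fun k _ => ?_
    rw [eval_mul, eval_C, descPochhammer_eval_eq_descFactorial, nsmul_eq_mul,
      Nat.descFactorial_eq_factorial_mul_choose]
    have : (k.factorial : ℂ) ≠ 0 := by exact_mod_cast k.factorial_ne_zero
    push_cast
    field_simp

open Polynomial in
/-- Fréchet's theorem on the real line. -/
theorem exists_polynomial_of_frechet {N : ℕ} {g : ℝ → ℂ} (hg : Continuous g)
    (heq : ∀ x h : ℝ, ∑ j ∈ Finset.range (N + 2),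
      ((N + 1).choose j : ℂ) * (-1 : ℂ) ^ (N + 1 - j) * g (x + (j : ℝ) * h) = 0) :
    ∃ P : ℂ[X], P.natDegree ≤ N ∧ ∀ t : ℝ, g t = P.eval (t : ℂ) := by
  have lattice : ∀ x h : ℝ, ∃ Q : ℂ[X], Q.natDegree ≤ N ∧
      ∀ n : ℕ, g (x + n * h) = Q.eval (n : ℂ) := by
    intro x h
    refine exists_polynomial_of_fwdDiff_iter_eq_zero (u := fun n : ℕ => g (x + n * h)) ?_
    ext n
    rw [fwdDiff_iter_eq_sum_shift, Pi.zero_apply, ← heq (x + n * h) h]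
    refine Finset.sum_congr rfl fun j _ => ?_
    rw [zsmul_eq_mul]
    push_cast
    simp only [smul_eq_mul, mul_one]
    ring_nf
  obtain ⟨P, hPdeg, hP⟩ := lattice 0 1
  simp only [zero_add, mul_one] at hP
  refine ⟨P, hPdeg, fun t => ?_⟩
  have hrat : ∀ r : ℚ, g (r : ℝ) = P.eval (((r : ℝ) : ℂ)) := by
    intro r
    obtain ⟨K, hK⟩ : ∃ K : ℕ, -r.num ≤ K := ⟨(-r.num).toNat, Int.self_le_toNat _⟩
    have hm : (r.den : ℝ) ≠ 0 := by exact_mod_cast r.den_ne_zero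
    obtain ⟨Q, -, hQ⟩ := lattice (-K) (1 / r.den)
    have hQP : Q.comp (C (r.den : ℂ) * (X + C (K : ℂ))) = P := by
      refine eq_of_infinite_eval_eq _ _
        ((Set.infinite_range_of_injective (Nat.cast_injective (R := ℂ))).mono ?_)
      rintro _ ⟨l, rfl⟩
      have h := hQ (r.den * (l + K))
      have e : (-K + ((r.den * (l + K) : ℕ) : ℝ) * (1 / r.den) : ℝ) = l := by
        push_cast
        field_simp
        ring
      rw [e, hP] at h
      simp only [Set.mem_ofPred_eq, eval_comp, eval_mul, eval_C, eval_add, eval_X]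
      rw [h]
      push_cast
      rfl
    have hr : ((r : ℝ)) * r.den = r.num := by exact_mod_cast Rat.mul_den_eq_num r
    obtain ⟨n, hn⟩ : ∃ n : ℕ, (n : ℤ) = r.num + K * r.den := by
      refine ⟨(r.num + K * r.den).toNat, Int.toNat_of_nonneg ?_⟩
      have : (1 : ℤ) ≤ r.den := by exact_mod_cast r.den_pos
      nlinarith
    have hnR : (n : ℝ) = r.den * (r + K) := by
      have : (n : ℝ) = r.num + K * r.den := by exact_mod_cast hn
      rw [this, ← hr]
      ring
    have h := hQ n
    have e : (-K + (n : ℝ) * (1 / r.den) : ℝ) = r := by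
      rw [hnR]
      field_simp
      ring
    rw [e] at h
    have hnC : (n : ℂ) = r.den * (((r : ℝ) : ℂ) + K) := by exact_mod_cast congrArg Complex.ofReal hnR
    rw [h, ← hQP, hnC]
    simp
  have hcont : Continuous fun t : ℝ => P.eval (t : ℂ) :=
    P.continuous.comp Complex.continuous_ofReal
  exact congrFun (Rat.denseRange_cast.equalizer hg hcont (funext hrat)) t

open Polynomial in
/-- A function on `ℝ^d` whose restriction to every line is a polynomial of degree at most `N` is
a polynomial. -/
theorem exists_mvPolynomial_of_forall_lines (N : ℕ) : ∀ {d : ℕ} {f : (Fin d → ℝ) → ℂ},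
    (∀ x y : Fin d → ℝ, ∃ P : ℂ[X], P.natDegree ≤ N ∧
      ∀ t : ℝ, f (x + t • y) = P.eval (t : ℂ)) →
    ∃ p : MvPolynomial (Fin d) ℂ, ∀ x, f x = MvPolynomial.eval (fun j => (x j : ℂ)) p
  | 0, f, _ => ⟨MvPolynomial.C (f 0), fun x => by
      rw [MvPolynomial.eval_C, Subsingleton.elim x 0]⟩
  | d + 1, f, hf => by
    have ih : ∀ a : ℕ, ∃ q : MvPolynomial (Fin d) ℂ, ∀ y : Fin d → ℝ,
        f (Fin.cons (a : ℝ) y) = MvPolynomial.eval (fun j => (y j : ℂ)) q := by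
      intro a
      refine exists_mvPolynomial_of_forall_lines N
        (f := fun y => f (Fin.cons (a : ℝ) y)) fun x y => ?_
      obtain ⟨P, hP, h⟩ := hf (Fin.cons (a : ℝ) x) (Fin.cons 0 y)
      refine ⟨P, hP, fun t => ?_⟩
      rw [← h]
      congr 1
      ext i
      refine Fin.cases ?_ (fun i => ?_) i <;> simp
    choose q hq using ih
    let L : ℕ → ℂ[X] := Lagrange.basis (Finset.range (N + 1)) (fun a : ℕ => (a : ℂ))
    refine ⟨∑ a ∈ Finset.range (N + 1),
      MvPolynomial.rename Fin.succ (q a) * aeval (MvPolynomial.X 0) (L a), fun x => ?_⟩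
    obtain ⟨P, hP, h⟩ := hf (Fin.cons 0 (Fin.tail x)) (Fin.cons 1 0)
    have hline : ∀ t : ℝ, f (Fin.cons t (Fin.tail x)) = P.eval (t : ℂ) := by
      intro t
      rw [← h]
      congr 1
      ext i
      refine Fin.cases ?_ (fun i => ?_) i <;> simp
    have hinterp := Lagrange.eq_interpolate (s := Finset.range (N + 1))
      (v := fun a : ℕ => (a : ℂ)) (f := P) (Nat.cast_injective.injOn) (by
        rw [Finset.card_range]
        exact lt_of_le_of_lt degree_le_natDegree (by exact_mod_cast Nat.lt_succ_of_le hP))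
    conv_lhs => rw [← Fin.cons_self_tail x]
    rw [hline, hinterp, Lagrange.interpolate_apply, eval_finsetSum, map_sum]
    refine Finset.sum_congr rfl fun a _ => ?_
    have ha := hline a
    rw [hq] at ha
    rw [eval_mul, eval_C, map_mul, MvPolynomial.eval_rename]
    congr 1
    · rw [← Complex.ofReal_natCast, ← ha]
      rfl
    · rw [aeval_def, hom_eval₂]
      simp [L, eval, eval₂_eq_sum, Polynomial.sum]

open Polynomial in
/-- A polynomial whose restriction to every real line through the origin has degree at most `N`
has total degree at most `N`. -/
theorem totalDegree_le_of_eval_lines {d N : ℕ} {p : MvPolynomial (Fin d) ℂ}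
    (hp : ∀ y : Fin d → ℝ, ∃ P : ℂ[X], P.natDegree ≤ N ∧
      ∀ t : ℝ, MvPolynomial.eval (fun j => ((t * y j : ℝ) : ℂ)) p = P.eval (t : ℂ)) :
    p.totalDegree ≤ N := by
  have hcomp : ∀ k, N < k → MvPolynomial.homogeneousComponent k p = 0 := by
    intro k hk
    by_cases hkp : p.totalDegree < k
    · exact MvPolynomial.homogeneousComponent_eq_zero _ _ hkp
    refine MvPolynomial.funext_set (fun _ => Set.range ((↑) : ℝ → ℂ))
      (fun _ => Set.infinite_range_of_injective Complex.ofReal_injective) fun z hz => ?_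
    choose y hy using fun i => hz i (Set.mem_univ i)
    obtain rfl : (fun i => (y i : ℂ)) = z := funext hy
    obtain ⟨P, hP, h⟩ := hp y
    have hPeq : ∑ i ∈ Finset.range (p.totalDegree + 1),
        C (MvPolynomial.eval (fun i => (y i : ℂ)) (MvPolynomial.homogeneousComponent i p)) * X ^ i
          = P := by
      refine eq_of_infinite_eval_eq _ _
        ((Set.infinite_range_of_injective Complex.ofReal_injective).mono ?_)
      rintro _ ⟨t, rfl⟩
      rw [Set.mem_ofPred_eq, ← h, eval_finsetSum]
      conv_rhs => rw [← MvPolynomial.sum_homogeneousComponent p, map_sum]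
      refine Finset.sum_congr rfl fun i _ => ?_
      rw [eval_mul, eval_C, eval_pow, eval_X, MvPolynomial.eval_eq, MvPolynomial.eval_eq,
        Finset.sum_mul]
      refine Finset.sum_congr rfl fun m hm => ?_
      have hmi := MvPolynomial.homogeneousComponent_isHomogeneous i p
        (MvPolynomial.mem_support_iff.mp hm)
      simp_rw [Complex.ofReal_mul, mul_pow, Finset.prod_mul_distrib, Finset.prod_pow_eq_pow_sum]
      rw [← hmi, Finsupp.weight_apply]
      simp only [Finsupp.sum, Pi.one_apply, smul_eq_mul, mul_one]
      ring
    have hcoeff := coeff_eq_zero_of_natDegree_lt (lt_of_le_of_lt hP hk)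
    rw [← hPeq, finsetSum_coeff] at hcoeff
    simp only [coeff_C_mul, coeff_X_pow, mul_ite, mul_one, mul_zero, Finset.sum_ite_eq,
      Finset.mem_range] at hcoeff
    rw [if_pos (by omega)] at hcoeff
    rw [hcoeff, map_zero]
  rw [MvPolynomial.totalDegree, Finset.sup_le_iff]
  intro m hm
  by_contra! hlt
  refine MvPolynomial.mem_support_iff.mp hm ?_
  have := congrArg (MvPolynomial.coeff m) (hcomp _ hlt)
  rw [MvPolynomial.coeff_homogeneousComponent] at this
  rwa [if_pos (by rfl), MvPolynomial.coeff_zero] at this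

theorem stmt_18 {d N : ℕ} (hd : 1 ≤ d)
    (f : (Fin d → ℝ) → ℂ) (hf : Continuous f)
    (heq : ∀ x h : Fin d → ℝ,
      ∑ j ∈ Finset.range (N + 2),
        ((N + 1).choose j : ℂ) * (-1 : ℂ) ^ (N + 1 - j) * f (x + (j : ℝ) • h) = 0) :
    IsPolyFunOfDegLE f N := by
  have hline : ∀ x y : Fin d → ℝ, ∃ P : Polynomial ℂ, P.natDegree ≤ N ∧
      ∀ t : ℝ, f (x + t • y) = P.eval (t : ℂ) := by
    intro x y
    refine exists_polynomial_of_frechet (g := fun t => f (x + t • y)) (by fun_prop) fun s h => ?_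
    rw [← heq (x + s • y) (h • y)]
    refine Finset.sum_congr rfl fun j _ => ?_
    rw [add_smul, mul_smul, add_assoc]
  obtain ⟨p, hp⟩ := exists_mvPolynomial_of_forall_lines N hline
  refine ⟨p, totalDegree_le_of_eval_lines fun y => ?_, hp⟩
  obtain ⟨P, hP, h⟩ := hline 0 y
  refine ⟨P, hP, fun t => ?_⟩
  rw [← h, hp]
  simp
end

section
/- Let d, n ≥ 1 be integers, let f : ℝ^d → ℂ be a continuous function, and let a_1, …, a_n, v_1, …, v_n : ℝ^d → ℂ be arbitrary functions such that the Levi-Civita functional equation f(x + y) = ∑_{i=1}^n a_i(y) v_i(x) holds for all x, y ∈ ℝ^d. Then f is a continuous exponential polynomial. -/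
/-- `f : ℝ^d → ℂ` is a continuous exponential polynomial: a finite sum
`∑ₖ pₖ(x) exp(⟨λₖ, x⟩)` with `pₖ` multivariate polynomials and `λₖ ∈ ℂ^d`. -/
def IsExpPoly {d : ℕ} (f : (Fin d → ℝ) → ℂ) : Prop :=
  ∃ (N : ℕ), 0 < N ∧ ∃ (p : Fin N → MvPolynomial (Fin d) ℂ) (lam : Fin N → Fin d → ℂ),
    ∀ x : Fin d → ℝ, f x = ∑ k, (MvPolynomial.eval (fun j => (x j : ℂ)) (p k)) *
      Complex.exp (∑ j, lam k j * (x j : ℂ))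

open Filter Topology

namespace IsExpPoly

variable {d : ℕ} {f g : (Fin d → ℝ) → ℂ}

theorem of_fintype {ι : Type*} [Fintype ι] [Nonempty ι] (p : ι → MvPolynomial (Fin d) ℂ)
    (lam : ι → Fin d → ℂ)
    (h : ∀ x, f x = ∑ k, (MvPolynomial.eval (fun j => (x j : ℂ)) (p k)) *
      Complex.exp (∑ j, lam k j * (x j : ℂ))) : IsExpPoly f := by
  refine ⟨Fintype.card ι, Fintype.card_pos, fun k => p ((Fintype.equivFin ι).symm k),
    fun k => lam ((Fintype.equivFin ι).symm k), fun x => ?_⟩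
  rw [h x]
  exact ((Fintype.equivFin ι).symm.sum_comp (fun k =>
    (MvPolynomial.eval (fun j => (x j : ℂ)) (p k)) *
      Complex.exp (∑ j, lam k j * (x j : ℂ)))).symm

theorem const (c : ℂ) : IsExpPoly (fun _ : Fin d → ℝ => c) :=
  of_fintype (ι := Unit) (fun _ => MvPolynomial.C c) (fun _ _ => 0) (by simp)

theorem add (hf : IsExpPoly f) (hg : IsExpPoly g) : IsExpPoly (fun x => f x + g x) := by
  obtain ⟨N, hN, p, l, hf⟩ := hf
  obtain ⟨M, hM, q, m, hg⟩ := hg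
  have : Nonempty (Fin N) := ⟨⟨0, hN⟩⟩
  refine of_fintype (ι := Fin N ⊕ Fin M) (Sum.elim p q) (Sum.elim l m) fun x => ?_
  simp [hf, hg]

theorem mul (hf : IsExpPoly f) (hg : IsExpPoly g) : IsExpPoly (fun x => f x * g x) := by
  obtain ⟨N, hN, p, l, hf⟩ := hf
  obtain ⟨M, hM, q, m, hg⟩ := hg
  have : Nonempty (Fin N) := ⟨⟨0, hN⟩⟩
  have : Nonempty (Fin M) := ⟨⟨0, hM⟩⟩
  refine of_fintype (ι := Fin N × Fin M) (fun k => p k.1 * q k.2)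
    (fun k => l k.1 + m k.2) fun x => ?_
  rw [hf, hg, Finset.sum_mul_sum, Fintype.sum_prod_type]
  refine Finset.sum_congr rfl fun i _ => Finset.sum_congr rfl fun k _ => ?_
  simp only [map_mul, Pi.add_apply, add_mul, Finset.sum_add_distrib, Complex.exp_add]
  ring

theorem sum {ι : Type*} (s : Finset ι) {F : ι → (Fin d → ℝ) → ℂ}
    (h : ∀ i ∈ s, IsExpPoly (F i)) : IsExpPoly (fun x => ∑ i ∈ s, F i x) := by
  classical
  induction s using Finset.induction_on with
  | empty => simpa using const 0
  | insert i s hi ih =>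
    simp only [Finset.sum_insert hi]
    exact (h i (by simp)).add (ih fun k hk => h k (by simp [hk]))

theorem polynomial_mul_exp (P : Polynomial ℂ) (μ : ℂ) (j : Fin d) :
    IsExpPoly (fun x : Fin d → ℝ => P.eval (x j : ℂ) * Complex.exp (μ * (x j : ℂ))) := by
  refine of_fintype (ι := Unit) (fun _ => Polynomial.aeval (MvPolynomial.X j) P)
    (fun _ => Pi.single j μ) fun x => ?_
  have h : MvPolynomial.eval (fun j => (x j : ℂ)) (Polynomial.aeval (MvPolynomial.X j) P) =
      P.eval (x j : ℂ) := by
    rw [← MvPolynomial.coe_aeval_eq_eval, RingHom.coe_coe, ← Polynomial.aeval_algHom_apply]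
    simp [Polynomial.coe_aeval_eq_eval]
  simp [h, Pi.single_apply]

end IsExpPoly

/-- On a finite-dimensional space of functions, every function is recovered linearly from
finitely many of its values. -/
theorem Submodule.exists_eval_interpolation {X K : Type*} [Field K] (V : Submodule K (X → K))
    [FiniteDimensional K V] :
    ∃ (m : ℕ) (w : Fin m → X → K) (c : Fin m → X →₀ K), (∀ i, w i ∈ V) ∧
      ∀ g ∈ V, ∀ x, g x = ∑ i, (∑ z ∈ (c i).support, c i z * g z) * w i x := by
  let e : X → Module.Dual K V := fun x => (LinearMap.proj x).comp V.subtype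
  have he : span K (Set.range e) = ⊤ := by
    have h : (span K (Set.range e)).dualCoannihilator = ⊥ := by
      rw [eq_bot_iff]
      intro g hg
      rw [Submodule.mem_dualCoannihilator] at hg
      rw [Submodule.mem_bot]
      ext x
      exact hg (e x) (subset_span ⟨x, rfl⟩)
    rw [← Subspace.dualCoannihilator_dualAnnihilator_eq (W := span K (Set.range e)), h,
      Submodule.dualAnnihilator_bot]
  let b := Module.finBasis K V
  have hc : ∀ i, ∃ c : X →₀ K, Finsupp.linearCombination K e c = b.coord i := fun i => by
    rw [← LinearMap.mem_range, Finsupp.range_linearCombination, he]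
    trivial
  choose c hc using hc
  refine ⟨_, fun i => b i, c, fun i => (b i).2, fun g hg x => ?_⟩
  have h1 := congrArg (fun u : V => (u : X → K) x) (b.sum_repr ⟨g, hg⟩)
  have h2 : ∀ i, b.repr ⟨g, hg⟩ i = ∑ z ∈ (c i).support, c i z * g z := fun i => by
    have := congrArg (fun φ : Module.Dual K V => φ ⟨g, hg⟩) (hc i)
    simpa [Finsupp.linearCombination_apply, Finsupp.sum, e] using this.symm
  simp only [h2] at h1
  simpa using h1.symm

theorem Polynomial.exists_derivative_eq {K : Type*} [Field K] [CharZero K] (P : Polynomial K) :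
    ∃ Q : Polynomial K, Q.derivative = P := by
  induction P using Polynomial.induction_on' with
  | add p q hp hq =>
    obtain ⟨P, rfl⟩ := hp
    obtain ⟨Q, rfl⟩ := hq
    exact ⟨P + Q, Polynomial.derivative_add⟩
  | monomial n a =>
    refine ⟨Polynomial.monomial (n + 1) (a / (n + 1)), ?_⟩
    have : (n + 1 : K) ≠ 0 := by exact_mod_cast n.succ_ne_zero
    simp [this]

theorem exists_polynomial_mul_exp_of_pow_eq_zero {V : Submodule ℂ (ℝ → ℂ)}
    (D : Module.End ℂ V)
    (hD : ∀ (g : V) (t : ℝ), HasDerivAt (g : ℝ → ℂ) ((D g : ℝ → ℂ) t) t) (μ : ℂ) (k : ℕ) :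
    ∀ g : V, ((D - μ • (1 : Module.End ℂ V)) ^ k) g = 0 →
      ∃ P : Polynomial ℂ, ∀ t : ℝ, (g : ℝ → ℂ) t = P.eval (t : ℂ) * Complex.exp (μ * t) := by
  induction k with
  | zero =>
    intro g hg
    have hg0 : g = 0 := by simpa using hg
    exact ⟨0, by simp [hg0]⟩
  | succ k ih =>
    intro g hg
    obtain ⟨P, hP⟩ := ih ((D - μ • (1 : Module.End ℂ V)) g) (by
      rwa [pow_succ] at hg)
    obtain ⟨Q, hQ⟩ := P.exists_derivative_eq
    let u : ℝ → ℂ := fun t => (g : ℝ → ℂ) t * Complex.exp (-(μ * t)) - Q.eval (t : ℂ)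
    have hu : ∀ t, HasDerivAt u 0 t := fun t => by
      have h1 : HasDerivAt (fun t : ℝ => Complex.exp (-(μ * t)))
          (Complex.exp (-(μ * t)) * -(μ * 1)) t :=
        ((Complex.ofRealCLM.hasDerivAt (x := t)).const_mul μ).neg.cexp
      have h2 : HasDerivAt (fun t : ℝ => Q.eval (t : ℂ)) (P.eval (t : ℂ)) t := by
        rw [← hQ]
        exact (Q.hasDerivAt (t : ℂ)).comp_ofReal
      have h3 := ((hD g t).mul h1).sub h2
      refine h3.congr_deriv ?_
      have h4 : (D g : ℝ → ℂ) t - μ * (g : ℝ → ℂ) t = P.eval (t : ℂ) * Complex.exp (μ * t) := by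
        rw [← hP t]
        simp
      have h5 : Complex.exp (μ * t) * Complex.exp (-(μ * t)) = 1 := by
        rw [← Complex.exp_add, add_neg_cancel, Complex.exp_zero]
      linear_combination Complex.exp (-(μ * t)) * h4 + P.eval (t : ℂ) * h5
    refine ⟨Q + Polynomial.C (u 0), fun t => ?_⟩
    have h6 : u t = u 0 :=
      is_const_of_deriv_eq_zero (fun t => (hu t).differentiableAt) (fun t => (hu t).deriv) t 0
    have h5 : Complex.exp (-(μ * t)) * Complex.exp (μ * t) = 1 := by
      rw [← Complex.exp_add, neg_add_cancel, Complex.exp_zero]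
    rw [← h6, Polynomial.eval_add, Polynomial.eval_C]
    linear_combination (-(g : ℝ → ℂ) t) * h5

section OneVariable

variable {V : Submodule ℂ (ℝ → ℂ)} [FiniteDimensional ℂ V]

theorem intervalIntegral_translate_mem (hcont : ∀ g ∈ V, Continuous g)
    (htr : ∀ g ∈ V, ∀ s : ℝ, (fun t => g (t + s)) ∈ V) {g : ℝ → ℂ} (hg : g ∈ V) (h : ℝ) :
    (fun x => ∫ y in (0 : ℝ)..h, g (x + y)) ∈ V := by
  obtain ⟨m, w, c, hw, hc⟩ := V.exists_eval_interpolation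
  have hgc := hcont g hg
  have : (fun x => ∫ y in (0 : ℝ)..h, g (x + y)) =
      ∑ i, (∫ y in (0 : ℝ)..h, ∑ z ∈ (c i).support, c i z * g (z + y)) • w i := by
    funext x
    rw [intervalIntegral.integral_congr (fun y _ => hc _ (htr g hg y) x),
      intervalIntegral.integral_finsetSum]
    · simp [intervalIntegral.integral_mul_const]
    · intro i _
      exact Continuous.intervalIntegrable (by fun_prop) _ _
  rw [this]
  exact V.sum_mem fun i _ => V.smul_mem _ (hw i)

theorem differentiable_of_mem_translation_invariant (hcont : ∀ g ∈ V, Continuous g)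
    (htr : ∀ g ∈ V, ∀ s : ℝ, (fun t => g (t + s)) ∈ V) {g : ℝ → ℂ} (hg : g ∈ V) :
    Differentiable ℝ g := by
  let D : Submodule ℂ (ℝ → ℂ) :=
    { carrier := {u | u ∈ V ∧ Differentiable ℝ u}
      add_mem' := fun hu hv => ⟨V.add_mem hu.1 hv.1, hu.2.add hv.2⟩
      zero_mem' := ⟨V.zero_mem, differentiable_const 0⟩
      smul_mem' := fun a _ hu => ⟨V.smul_mem a hu.1, hu.2.const_smul a⟩ }
  have hDV : D ≤ V := fun u hu => hu.1
  have : FiniteDimensional ℂ D := Submodule.finiteDimensional_of_le hDV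
  have hgc := hcont g hg
  let F : ℝ → ℂ := fun x => ∫ y in (0 : ℝ)..x, g y
  have hF : ∀ x, HasDerivAt F (g x) x := fun x =>
    intervalIntegral.integral_hasDerivAt_right (hgc.intervalIntegrable _ _)
      (hgc.stronglyMeasurableAtFilter _ _) hgc.continuousAt
  have hFd : Differentiable ℝ F := fun x => (hF x).differentiableAt
  have hmem : ∀ h : ℝ, (fun x => h⁻¹ • (F (x + h) - F x)) ∈ D := fun h => by
    have hV := intervalIntegral_translate_mem hcont htr hg h
    have hE : (fun x => ∫ y in (0 : ℝ)..h, g (x + y)) = fun x => F (x + h) - F x := by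
      funext x
      rw [intervalIntegral.integral_comp_add_left, add_zero]
      exact (intervalIntegral.integral_interval_sub_left (hgc.intervalIntegrable _ _)
        (hgc.intervalIntegrable _ _)).symm
    rw [hE] at hV
    refine ⟨?_, by fun_prop⟩
    simpa [Pi.smul_def] using V.smul_mem ((h⁻¹ : ℝ) : ℂ) hV
  have hlim : Tendsto (fun h : ℝ => fun x => h⁻¹ • (F (x + h) - F x)) (𝓝[≠] 0) (𝓝 g) :=
    tendsto_pi_nhds.2 fun x => hasDerivAt_iff_tendsto_slope_zero.1 (hF x)
  exact (D.closed_of_finiteDimensional.mem_of_tendsto hlim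
    (Eventually.of_forall hmem)).2

theorem deriv_mem_of_mem_translation_invariant (hcont : ∀ g ∈ V, Continuous g)
    (htr : ∀ g ∈ V, ∀ s : ℝ, (fun t => g (t + s)) ∈ V) {g : ℝ → ℂ} (hg : g ∈ V) :
    deriv g ∈ V := by
  have hd := differentiable_of_mem_translation_invariant hcont htr hg
  have hlim : Tendsto (fun h : ℝ => fun x => h⁻¹ • (g (x + h) - g x)) (𝓝[≠] 0) (𝓝 (deriv g)) :=
    tendsto_pi_nhds.2 fun x => hasDerivAt_iff_tendsto_slope_zero.1 (hd x).hasDerivAt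
  refine V.closed_of_finiteDimensional.mem_of_tendsto hlim (Eventually.of_forall fun h => ?_)
  simpa [Pi.smul_def] using
    V.smul_mem ((h⁻¹ : ℝ) : ℂ) (V.sub_mem (htr g hg h) hg)

theorem mem_span_polynomial_mul_exp (hcont : ∀ g ∈ V, Continuous g)
    (htr : ∀ g ∈ V, ∀ s : ℝ, (fun t => g (t + s)) ∈ V) {g : ℝ → ℂ} (hg : g ∈ V) :
    g ∈ Submodule.span ℂ {u : ℝ → ℂ | ∃ (P : Polynomial ℂ) (μ : ℂ),
      u = fun t : ℝ => P.eval (t : ℂ) * Complex.exp (μ * t)} := by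
  have hd : ∀ g ∈ V, Differentiable ℝ g := fun g hg =>
    differentiable_of_mem_translation_invariant hcont htr hg
  let D : Module.End ℂ V :=
    { toFun := fun g => ⟨deriv g, deriv_mem_of_mem_translation_invariant hcont htr g.2⟩
      map_add' := fun u v => Subtype.ext <| funext fun t =>
        deriv_add (hd u u.2 t) (hd v v.2 t)
      map_smul' := fun c u => Subtype.ext <| funext fun t =>
        deriv_const_smul c (hd u u.2 t) }
  have hD : ∀ (g : V) (t : ℝ), HasDerivAt (g : ℝ → ℂ) ((D g : ℝ → ℂ) t) t :=
    fun g t => (hd g g.2 t).hasDerivAt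
  have hle : (⨆ μ : ℂ, D.maxGenEigenspace μ) ≤
      (Submodule.span ℂ {u : ℝ → ℂ | ∃ (P : Polynomial ℂ) (μ : ℂ),
        u = fun t : ℝ => P.eval (t : ℂ) * Complex.exp (μ * t)}).comap V.subtype := by
    refine iSup_le fun μ u hu => ?_
    obtain ⟨k, hk⟩ := (D.mem_maxGenEigenspace μ u).1 hu
    obtain ⟨P, hP⟩ := exists_polynomial_mul_exp_of_pow_eq_zero D hD μ k u hk
    exact Submodule.subset_span ⟨P, μ, funext hP⟩
  rw [D.iSup_maxGenEigenspace_eq_top] at hle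
  exact hle (x := ⟨g, hg⟩) trivial

theorem IsExpPoly.comp_coordinate_of_mem_translation_invariant {d : ℕ}
    (hcont : ∀ g ∈ V, Continuous g) (htr : ∀ g ∈ V, ∀ s : ℝ, (fun t => g (t + s)) ∈ V)
    {g : ℝ → ℂ} (hg : g ∈ V) (j : Fin d) : IsExpPoly (fun x : Fin d → ℝ => g (x j)) := by
  have hspan := mem_span_polynomial_mul_exp hcont htr hg
  clear hg
  induction hspan using Submodule.span_induction with
  | mem u hu =>
    obtain ⟨P, μ, rfl⟩ := hu
    exact polynomial_mul_exp P μ j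
  | zero => exact const 0
  | add u v _ _ hu hv => exact hu.add hv
  | smul c u _ hu => exact (const c).mul hu

end OneVariable

theorem IsExpPoly.of_mem_translation_invariant {d : ℕ} {V : Submodule ℂ ((Fin d → ℝ) → ℂ)}
    [FiniteDimensional ℂ V] (hcont : ∀ g ∈ V, Continuous g)
    (htr : ∀ g ∈ V, ∀ s, (fun x => g (x + s)) ∈ V) {g : (Fin d → ℝ) → ℂ} (hg : g ∈ V) :
    IsExpPoly g := by
  obtain ⟨m, w, c, hw, hc⟩ := V.exists_eval_interpolation
  have hline : ∀ g ∈ V, ∀ (z : Fin d → ℝ) (j : Fin d),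
      IsExpPoly (fun x : Fin d → ℝ => g (z + Pi.single j (x j))) := by
    intro g hg z j
    let R : ((Fin d → ℝ) → ℂ) →ₗ[ℂ] (ℝ → ℂ) :=
      LinearMap.funLeft ℂ ℂ (fun t : ℝ => z + Pi.single j t)
    have hRc : ∀ u ∈ V.map R, Continuous u := by
      rintro _ ⟨u, hu, rfl⟩
      exact (hcont u hu).comp (continuous_const.add (continuous_single (A := fun _ : Fin d => ℝ) j))
    have hRt : ∀ u ∈ V.map R, ∀ s : ℝ, (fun t => u (t + s)) ∈ V.map R := by
      rintro _ ⟨u, hu, rfl⟩ s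
      refine ⟨_, htr u hu (Pi.single j s), funext fun t => ?_⟩
      simp [R, LinearMap.funLeft_apply, Pi.single_add, add_assoc]
    exact comp_coordinate_of_mem_translation_invariant hRc hRt
      (Submodule.mem_map_of_mem (f := R) hg) j
  have key : ∀ s : Finset (Fin d), ∀ g ∈ V,
      IsExpPoly (fun x : Fin d → ℝ => g (∑ j ∈ s, Pi.single j (x j))) := by
    intro s
    induction s using Finset.induction_on with
    | empty => simpa using fun g _ => const _
    | insert j s hj ih =>
      intro g hg
      have h : (fun x : Fin d → ℝ => g (∑ k ∈ insert j s, Pi.single k (x k))) = fun x =>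
          ∑ i, (∑ z ∈ (c i).support, c i z * g (z + Pi.single j (x j))) *
            w i (∑ k ∈ s, Pi.single k (x k)) := by
        funext x
        rw [Finset.sum_insert hj, add_comm]
        exact hc _ (htr g hg (Pi.single j (x j))) _
      rw [h]
      exact sum _ fun i _ => (sum _ fun z _ => (const _).mul (hline g hg z j)).mul (ih _ (hw i))
  simpa [Finset.univ_sum_single] using key Finset.univ g hg

theorem stmt_19 {d n : ℕ} (hd : 1 ≤ d) (hn : 1 ≤ n)
    (f : (Fin d → ℝ) → ℂ) (hf : Continuous f)
    (a v : Fin n → (Fin d → ℝ) → ℂ)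
    (heq : ∀ x y : Fin d → ℝ, f (x + y) = ∑ i, a i y * v i x) :
    IsExpPoly f := by
  let V : Submodule ℂ ((Fin d → ℝ) → ℂ) := Submodule.span ℂ (Set.range fun y x => f (x + y))
  have hV : V ≤ Submodule.span ℂ (Set.range v) := by
    refine Submodule.span_le.2 ?_
    rintro _ ⟨y, rfl⟩
    have h : (fun x => f (x + y)) = ∑ i, a i y • v i := by
      funext x
      simp [heq]
    simp only [h]
    exact Submodule.sum_mem _ fun i _ => Submodule.smul_mem _ _ (Submodule.subset_span ⟨i, rfl⟩)
  have : FiniteDimensional ℂ (Submodule.span ℂ (Set.range v)) :=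
    FiniteDimensional.span_of_finite ℂ (Set.finite_range v)
  have : FiniteDimensional ℂ V := Submodule.finiteDimensional_of_le hV
  refine IsExpPoly.of_mem_translation_invariant (V := V) ?_ ?_
    (Submodule.subset_span ⟨0, by simp⟩)
  · intro g hg
    induction hg using Submodule.span_induction with
    | mem u hu =>
      obtain ⟨y, rfl⟩ := hu
      fun_prop
    | zero => exact continuous_const
    | add u v _ _ hu hv => exact hu.add hv
    | smul c u _ hu => exact hu.const_smul c
  · intro g hg s
    induction hg using Submodule.span_induction with
    | mem u hu =>
      obtain ⟨y, rfl⟩ := hu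
      exact Submodule.subset_span ⟨s + y, funext fun x => by simp [add_assoc]⟩
    | zero => exact V.zero_mem
    | add u v _ _ hu hv => exact V.add_mem hu hv
    | smul c u _ hu => exact V.smul_mem c hu
end
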